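/- Suppose f is differentiable and satisfies the block smoothness assumption: for every j ∈ [m] and all x, y ∈ ℝ^d differing only in block j, ‖∇^j f(x) − ∇^j f(y)‖_{Λ_j^{-1}} ≤ ‖x^j − y^j‖_{Λ_j}. Let η > 0, x_{k−1} ∈ ℝ^d, and suppose x_k is obtained from x_{k−1} by one VR-CCD cycle with stepsize η, gradient estimates g^1, …, g^m, and subgradients s^1, …, s^m. Then F(x_k) ≤ F(x_{k−1}) − ((1−η)/(2η))‖x_k − x_{k−1}‖²_Λ + (η/2)Σ_{j=1}^m ‖g^j − ∇^j f(x_{k−1,j})‖²_{Λ_j^{-1}} − (η/2)Σ_{j=1}^m ‖∇^j f(x_{k−1,j}) + s^j‖²_{Λ_j^{-1}}. -/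

import Mathlib

open Finset

/-- Weighted Young inequality for the pairing of `a` and `v`, when the dual weighted norm of `a`
is at most `t` times the weighted norm of `v`. -/
lemma sum_mul_le_of_weighted_sq_le {ι : Type*} (S : Finset ι) (γ a v : ι → ℝ)
    (hγ : ∀ i, 0 < γ i) {t : ℝ} (ht : 0 < t)
    (h : ∑ i ∈ S, a i ^ 2 / γ i ≤ t ^ 2 * ∑ i ∈ S, γ i * v i ^ 2) :
    ∑ i ∈ S, a i * v i ≤ t * ∑ i ∈ S, γ i * v i ^ 2 := by
  have young : ∀ i ∈ S, 2 * t * (a i * v i) ≤ a i ^ 2 / γ i + t ^ 2 * (γ i * v i ^ 2) := by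
    intro i _
    have hi := hγ i
    have hsq : a i ^ 2 / γ i + t ^ 2 * (γ i * v i ^ 2) - 2 * t * (a i * v i)
        = (a i - t * γ i * v i) ^ 2 / γ i := by
      field_simp
      ring
    have : 0 ≤ (a i - t * γ i * v i) ^ 2 / γ i := by positivity
    linarith
  have hsum := Finset.sum_le_sum young
  rw [← Finset.mul_sum, Finset.sum_add_distrib, ← Finset.mul_sum] at hsum
  refine le_of_mul_le_mul_left ?_ (by positivity : 0 < 2 * t)
  linarith

/-- Descent lemma along a set `S` of coordinates: if the `S`-part of the gradient is 1-Lipschitz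
between the weighted norm and its dual, `f` has the usual quadratic upper bound. -/
lemma block_descent {ι : Type*} [Fintype ι] (S : Finset ι) (γ : ι → ℝ) (hγ : ∀ i, 0 < γ i)
    (f : EuclideanSpace ℝ ι → ℝ) (f' : EuclideanSpace ℝ ι → EuclideanSpace ℝ ι)
    (hf : ∀ x, HasGradientAt f (f' x) x)
    (hsmooth : ∀ x y : EuclideanSpace ℝ ι, (∀ i, i ∉ S → x i = y i) →
      Real.sqrt (∑ i ∈ S, (f' x i - f' y i) ^ 2 / γ i) ≤
        Real.sqrt (∑ i ∈ S, γ i * (x i - y i) ^ 2))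
    (x y : EuclideanSpace ℝ ι) (hxy : ∀ i, i ∉ S → x i = y i) :
    f y ≤ f x + ∑ i ∈ S, f' x i * (y i - x i) + 1 / 2 * ∑ i ∈ S, γ i * (y i - x i) ^ 2 := by
  set Q := ∑ i ∈ S, γ i * (y i - x i) ^ 2 with hQ
  set L := ∑ i ∈ S, f' x i * (y i - x i) with hL
  have hinner : ∀ z, inner ℝ (f' z) (y - x) = ∑ i ∈ S, f' z i * (y i - x i) := by
    intro z
    rw [PiLp.inner_apply, ← Finset.sum_subset (Finset.subset_univ S)]
    · exact Finset.sum_congr rfl fun i _ => by simp [mul_comm]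
    · intro i _ hi
      simp [hxy i hi]
  have hderiv : ∀ t : ℝ, HasDerivAt (fun t : ℝ => f (x + t • (y - x)) - t * L - t ^ 2 / 2 * Q)
      (∑ i ∈ S, f' (x + t • (y - x)) i * (y i - x i) - L - t * Q) t := by
    intro t
    have hline : HasDerivAt (fun t : ℝ => x + t • (y - x)) (y - x) t := by
      simpa using ((hasDerivAt_id t).smul_const (y - x)).const_add x
    have hcomp := (hf (x + t • (y - x))).hasFDerivAt.comp_hasDerivAt t hline
    rw [InnerProductSpace.toDual_apply_apply, hinner] at hcomp
    have hlin : HasDerivAt (fun t : ℝ => t * L) L t := by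
      simpa using (hasDerivAt_id t).mul_const L
    have hquad : HasDerivAt (fun t : ℝ => t ^ 2 / 2 * Q) (t * Q) t := by
      simpa using ((hasDerivAt_pow 2 t).div_const 2).mul_const Q
    exact (hcomp.sub hlin).sub hquad
  have hanti : AntitoneOn (fun t : ℝ => f (x + t • (y - x)) - t * L - t ^ 2 / 2 * Q)
      (Set.Icc 0 1) := by
    refine antitoneOn_of_hasDerivWithinAt_nonpos (convex_Icc 0 1)
      (fun t _ => (hderiv t).continuousAt.continuousWithinAt)
      (fun t _ => (hderiv t).hasDerivWithinAt) ?_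
    intro t ht
    rw [interior_Icc] at ht
    have hs := hsmooth (x + t • (y - x)) x fun i hi => by simp [hxy i hi]
    rw [Real.sqrt_le_sqrt_iff (Finset.sum_nonneg fun i _ =>
      mul_nonneg (hγ i).le (sq_nonneg _))] at hs
    have hscale : ∑ i ∈ S, γ i * ((x + t • (y - x)) i - x i) ^ 2 = t ^ 2 * Q := by
      rw [hQ, Finset.mul_sum]
      exact Finset.sum_congr rfl fun i _ => by simp; ring
    rw [hscale] at hs
    have hb := sum_mul_le_of_weighted_sq_le S γ (fun i => f' (x + t • (y - x)) i - f' x i)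
      (fun i => y i - x i) hγ ht.1 hs
    simp only [sub_mul, Finset.sum_sub_distrib] at hb
    linarith
  have h01 := hanti (Set.left_mem_Icc.2 zero_le_one) (Set.right_mem_Icc.2 zero_le_one) zero_le_one
  simp only [one_smul, add_sub_cancel, zero_smul, add_zero] at h01
  linarith

/-- Replacing blocks of `x` by those of `y` one at a time, the increments of `f` telescope. -/
lemma sum_block_increments {ι : Type*} {m : ℕ} (bl : ι → Fin m)
    (f : EuclideanSpace ℝ ι → ℝ) (x y : EuclideanSpace ℝ ι) :
    ∑ j : Fin m, (f (WithLp.toLp 2 fun i => if bl i ≤ j then y i else x i)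
        - f (WithLp.toLp 2 fun i => if bl i < j then y i else x i)) = f y - f x := by
  let X : ℕ → EuclideanSpace ℝ ι := fun n =>
    WithLp.toLp 2 fun i => if (bl i : ℕ) < n then y i else x i
  have hX0 : X 0 = x := by ext i; simp [X]
  have hXm : X m = y := by ext i; simp [X]
  have htel := Finset.sum_range_sub (fun n => f (X n)) m
  rw [hX0, hXm, ← Fin.sum_univ_eq_sum_range (fun n => f (X (n + 1)) - f (X n)) m] at htel
  rw [← htel]
  simp only [X, Nat.lt_succ_iff, Fin.le_def, Fin.lt_def]

/-- **Lemma 5 (descent for VR-CCD).** Coordinates are partitioned into `m`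
consecutive blocks via the monotone surjection `bl`; `γ` is the positive diagonal of
`Λ`; `R j` plays the role of `x ↦ r^j(x^j)` and `F = f + ∑ j, R j`.  The vectors
`g` and `s` are the concatenated gradient estimates `g^j` and subgradients
`s^j ∈ ∂r^j(x_k^j)` of one VR-CCD cycle with stepsize `η` (with
`xmid j = x_{k−1,j}`). -/
theorem stmt_7 (d m : ℕ) (hm : 1 ≤ m)
    (bl : Fin d → Fin m) (hmono : Monotone bl) (hsurj : Function.Surjective bl)
    (γ : Fin d → ℝ) (hγ : ∀ i, 0 < γ i)
    (f : EuclideanSpace ℝ (Fin d) → ℝ)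
    (f' : EuclideanSpace ℝ (Fin d) → EuclideanSpace ℝ (Fin d))
    (hf : ∀ x, HasGradientAt f (f' x) x)
    (R : Fin m → EuclideanSpace ℝ (Fin d) → ℝ)
    (hRdep : ∀ (j : Fin m) (x y : EuclideanSpace ℝ (Fin d)),
      (∀ i, bl i = j → x i = y i) → R j x = R j y)
    (hRconv : ∀ j, ConvexOn ℝ Set.univ (R j))
    (hsmooth : ∀ (j : Fin m) (x y : EuclideanSpace ℝ (Fin d)),
      (∀ i, bl i ≠ j → x i = y i) →
      Real.sqrt (∑ i ∈ univ.filter (fun i => bl i = j), (f' x i - f' y i) ^ 2 / γ i) ≤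
        Real.sqrt (∑ i ∈ univ.filter (fun i => bl i = j), γ i * (x i - y i) ^ 2))
    (η : ℝ) (hη : 0 < η)
    (g s : Fin d → ℝ)
    (xkm1 xk : EuclideanSpace ℝ (Fin d))
    (xmid : Fin m → EuclideanSpace ℝ (Fin d))
    (hxmid : ∀ (j : Fin m) (i : Fin d), xmid j i = if bl i < j then xk i else xkm1 i)
    (hsub : ∀ (j : Fin m) (z : EuclideanSpace ℝ (Fin d)),
      R j xk + ∑ i ∈ univ.filter (fun i => bl i = j), s i * (z i - xk i) ≤ R j z)
    (hupd : ∀ i : Fin d, xk i = xkm1 i - η * (1 / γ i) * (g i + s i)) :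
    f xk + ∑ j, R j xk ≤
      f xkm1 + ∑ j, R j xkm1
        - ((1 - η) / (2 * η)) * ∑ i, γ i * (xk i - xkm1 i) ^ 2
        + (η / 2) * ∑ j, ∑ i ∈ univ.filter (fun i => bl i = j),
            (g i - f' (xmid j) i) ^ 2 / γ i
        - (η / 2) * ∑ j, ∑ i ∈ univ.filter (fun i => bl i = j),
            (f' (xmid j) i + s i) ^ 2 / γ i := by
  have hstep : ∀ j : Fin m,
      (f (WithLp.toLp 2 fun i => if bl i ≤ j then xk i else xkm1 i)
        - f (WithLp.toLp 2 fun i => if bl i < j then xk i else xkm1 i)) + R j xk - R j xkm1 ≤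
      - ((1 - η) / (2 * η)) * ∑ i ∈ univ.filter (fun i => bl i = j), γ i * (xk i - xkm1 i) ^ 2
        + (η / 2) * ∑ i ∈ univ.filter (fun i => bl i = j), (g i - f' (xmid j) i) ^ 2 / γ i
        - (η / 2) * ∑ i ∈ univ.filter (fun i => bl i = j), (f' (xmid j) i + s i) ^ 2 / γ i := by
    intro j
    have hmid : (WithLp.toLp 2 fun i => if bl i < j then xk i else xkm1 i) = xmid j := by
      ext i
      simp [hxmid]
    rw [hmid]
    have hdesc := block_descent (univ.filter fun i => bl i = j) γ hγ f f' hf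
      (fun x y h => hsmooth j x y fun i hi => h i (by simpa using hi)) (xmid j)
      (WithLp.toLp 2 fun i => if bl i ≤ j then xk i else xkm1 i) (by
        intro i hi
        have hne : bl i ≠ j := by simpa using hi
        simp [hxmid, le_iff_lt_or_eq, hne])
    have hdiff : ∀ i ∈ univ.filter (fun i => bl i = j),
        (WithLp.toLp 2 fun i => if bl i ≤ j then xk i else xkm1 i : EuclideanSpace ℝ (Fin d)) i
          - xmid j i = xk i - xkm1 i := by
      intro i hi
      have hij : bl i = j := by simpa using hi
      simp [hxmid, hij]
    have hlin := Finset.sum_congr rfl fun i hi =>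
      congrArg (fun v => f' (xmid j) i * v) (hdiff i hi)
    have hquad := Finset.sum_congr rfl fun i hi => congrArg (fun v => γ i * v ^ 2) (hdiff i hi)
    rw [hlin, hquad] at hdesc
    have hR := hsub j xkm1
    have hid : ∑ i ∈ univ.filter (fun i => bl i = j), f' (xmid j) i * (xk i - xkm1 i)
        + 1 / 2 * ∑ i ∈ univ.filter (fun i => bl i = j), γ i * (xk i - xkm1 i) ^ 2
        - ∑ i ∈ univ.filter (fun i => bl i = j), s i * (xkm1 i - xk i)
        = - ((1 - η) / (2 * η)) * ∑ i ∈ univ.filter (fun i => bl i = j),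
            γ i * (xk i - xkm1 i) ^ 2
          + (η / 2) * ∑ i ∈ univ.filter (fun i => bl i = j), (g i - f' (xmid j) i) ^ 2 / γ i
          - (η / 2) * ∑ i ∈ univ.filter (fun i => bl i = j), (f' (xmid j) i + s i) ^ 2 / γ i := by
      simp only [Finset.mul_sum, ← Finset.sum_add_distrib, ← Finset.sum_sub_distrib]
      refine Finset.sum_congr rfl fun i _ => ?_
      have hi := (hγ i).ne'
      rw [hupd i]
      field_simp
      ring
    linarith
  have hsum := Finset.sum_le_sum fun j (_ : j ∈ univ) => hstep j
  rw [Finset.sum_sub_distrib, Finset.sum_add_distrib, sum_block_increments,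
    Finset.sum_sub_distrib, Finset.sum_add_distrib, ← Finset.mul_sum, ← Finset.mul_sum,
    ← Finset.mul_sum, Finset.sum_fiberwise] at hsum
  linarith
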